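/- For any s > 0 and 0 < ε < s/2, it holds that ‖u³ − 3(u² ≺ u)‖_{H^s(𝕋²)} ≲ ‖u‖³_{C^{s−ε}(𝕋²)}, with implicit constant independent of u. -/

import Mathlib

noncomputable section
open scoped BigOperators ENNReal NNReal
open MeasureTheory Filter

namespace SDNLW

/-- The frequency lattice of the two-dimensional torus. -/
abbrev Freq : Type := ℤ × ℤ

/-- A distribution on `𝕋²`, represented by its Fourier coefficients. -/
abbrev Distr : Type := Freq → ℂ

/-- A pair `(u, v)` of distributions on `𝕋²`. -/
abbrev VDistr : Type := Distr × Distr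

/-- The Japanese bracket `⟨n⟩ = (1 + |n|²)^{1/2}`. -/
def jap (n : Freq) : ℝ := Real.sqrt (1 + (n.1 : ℝ) ^ 2 + (n.2 : ℝ) ^ 2)

/-- Euclidean length of a frequency. -/
def fnorm (n : Freq) : ℝ := Real.sqrt ((n.1 : ℝ) ^ 2 + (n.2 : ℝ) ^ 2)

/-- The Fourier multiplier `⟨∇⟩^σ = (1 - Δ)^{σ/2}`. -/
def japMul (σ : ℝ) (u : Distr) : Distr := fun n => (Complex.ofReal (jap n ^ σ)) * u n

/-- The Fourier multiplier `|∇|^σ`, with symbol `|2πn|^σ`. -/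
def absMul (σ : ℝ) (u : Distr) : Distr :=
  fun n => (Complex.ofReal ((2 * Real.pi * fnorm n) ^ σ)) * u n

/-- The partial derivative `∂_j`, with symbol `2πi n_j`. -/
def pd (j : Fin 2) (u : Distr) : Distr :=
  fun n => (2 * Real.pi * Complex.I * (if j = 0 then (n.1 : ℂ) else (n.2 : ℂ))) * u n

/-- The product of two distributions (convolution of Fourier coefficients). -/
def dmul (u v : Distr) : Distr := fun n => ∑' m : Freq, u m * v (n - m)

/-- The cube `u³` of a distribution. -/
def cube (u : Distr) : Distr := dmul u (dmul u u)

/-- Littlewood–Paley projection `P_N`, `N = 2^j`. -/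
def LP (j : ℕ) (u : Distr) : Distr :=
  Set.indicator {n : Freq |
    if j = 0 then fnorm n ≤ 1 else ((2 : ℝ) ^ (j - 1) < fnorm n ∧ fnorm n ≤ (2 : ℝ) ^ j)} u

/-- The sum of the Littlewood–Paley pieces `P_N f` over `N < M/2`, `M = 2^k`. -/
def lowPass (k : ℕ) (f : Distr) : Distr := ∑ j ∈ Finset.range (k - 1), LP j f

/-- The low-high paraproduct `f ≺ g = ∑_{N < M/2} P_N f · P_M g`. -/
def para (f g : Distr) : Distr := fun n => ∑' k : ℕ, dmul (lowPass k f) (LP k g) n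

/-- Evaluation of (the trigonometric series of) a distribution at a point. -/
def eval (u : Distr) (x : ℝ × ℝ) : ℂ :=
  ∑' n : Freq, u n * Complex.exp (Complex.I * Complex.ofReal ((n.1 : ℝ) * x.1 + (n.2 : ℝ) * x.2))

/-- The `L^∞` norm. -/
def linfNorm (u : Distr) : ℝ≥0∞ := ⨆ x : ℝ × ℝ, (‖eval u x‖₊ : ℝ≥0∞)

/-- The `L^p` norm on `𝕋² ≃ [0,2π]²`. -/
def lpNorm (p : ℝ) (u : Distr) : ℝ≥0∞ :=
  (∫⁻ x in (Set.Icc (0:ℝ) (2 * Real.pi)) ×ˢ (Set.Icc (0:ℝ) (2 * Real.pi)),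
      ((‖eval u x‖₊ : ℝ≥0∞) ^ p)) ^ (1 / p)

/-- The Sobolev `H^σ` norm. -/
def sobNorm (σ : ℝ) (u : Distr) : ℝ≥0∞ :=
  (∑' n : Freq, (‖u n‖₊ : ℝ≥0∞) ^ 2 * ENNReal.ofReal (jap n ^ (2 * σ))) ^ (1 / 2 : ℝ)

/-- Abstract Besov-type norm built from a norm on Littlewood–Paley pieces, with `q = ∞`. -/
def besovInf (σ : ℝ) (bn : Distr → ℝ≥0∞) (u : Distr) : ℝ≥0∞ :=
  ⨆ j : ℕ, ENNReal.ofReal ((2 : ℝ) ^ ((j : ℝ) * σ)) * bn (LP j u)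

/-- The Besov–Hölder norm `C^σ = B^σ_{∞,∞}`. -/
def CNorm (σ : ℝ) (u : Distr) : ℝ≥0∞ := besovInf σ linfNorm u

/-- The Besov norm `B^σ_{2,∞}`. -/
def B2InfNorm (σ : ℝ) (u : Distr) : ℝ≥0∞ := besovInf σ (sobNorm 0) u

/-- The `L²` norm. -/
def L2Norm (u : Distr) : ℝ≥0∞ := sobNorm 0 u

/-- The `W^{α,p}` Sobolev norm. -/
def WNorm (α p : ℝ) (u : Distr) : ℝ≥0∞ := lpNorm p (japMul α u)

/-- The norm of `𝓒^α = C^α × C^{α-1}`. -/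
def CvNorm (α : ℝ) (u : VDistr) : ℝ≥0∞ := CNorm α u.1 + CNorm (α - 1) u.2

/-- The norm of `𝓗^α = H^α × H^{α-1}`. -/
def HvNorm (α : ℝ) (u : VDistr) : ℝ≥0∞ := sobNorm α u.1 + sobNorm (α - 1) u.2

/-- The norm of `𝓦^{α,p} = W^{α,p} × W^{α-1,p}`. -/
def WvNorm (α p : ℝ) (u : VDistr) : ℝ≥0∞ := WNorm α p u.1 + WNorm (α - 1) p u.2

/-- The symbol of `⟪∇⟫ = (3/4 - Δ)^{1/2}`. -/
def sb (n : Freq) : ℝ := Real.sqrt (3 / 4 + (n.1 : ℝ) ^ 2 + (n.2 : ℝ) ^ 2)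

/-- The matrix propagator `S(t)` of the linear damped wave equation
`∂_t² u + ∂_t u + (1 - Δ) u = 0`. -/
def Sprop (t : ℝ) (u : VDistr) : VDistr :=
  (fun n => Complex.ofReal (Real.exp (-t / 2)) *
      (Complex.ofReal (Real.cos (t * sb n) + Real.sin (t * sb n) / (2 * sb n)) * u.1 n
        + Complex.ofReal (Real.sin (t * sb n) / sb n) * u.2 n),
   fun n => Complex.ofReal (Real.exp (-t / 2)) *
      (Complex.ofReal (-((sb n + 1 / (4 * sb n)) * Real.sin (t * sb n))) * u.1 n
        + Complex.ofReal (Real.cos (t * sb n) - Real.sin (t * sb n) / (2 * sb n)) * u.2 n))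

/-- Frequencies in the square `[-N, N]²` (all of them when `N = ∞`). -/
def sqSet (N : ℕ∞) : Set Freq := {n | (n.1.natAbs : ℕ∞) ≤ N ∧ (n.2.natAbs : ℕ∞) ≤ N}

/-- The sharp frequency projection `Π_{≤N}`. -/
def proj (N : ℕ∞) (u : Distr) : Distr := (sqSet N).indicator u

/-- The sharp frequency projection `Π_{≤N}` on pairs. -/
def projV (N : ℕ∞) (u : VDistr) : VDistr := (proj N u.1, proj N u.2)

/-- Encoding of the index set `2^{ℕ₀} ∪ {∞}`: `some j ↦ 2^j`, `none ↦ ∞`. -/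
def dyadic : Option ℕ → ℕ∞
  | none => ⊤
  | some j => ((2 ^ j : ℕ) : ℕ∞)

/-- The `X^α` norm: for `0 < α < 1` it is `sup_{t ≥ 0} e^{t/8} ‖S(t)u⃗‖_{𝓦^{α,2/α}}`;
for `α ≥ 1` it is the `H^α × H^{α-1}` norm. -/
def XNorm (α : ℝ) (u : VDistr) : ℝ≥0∞ :=
  if α < 1 then
    ⨆ t : ℝ≥0, ENNReal.ofReal (Real.exp ((t : ℝ) / 8)) * WvNorm α (2 / α) (Sprop (t : ℝ) u)
  else HvNorm α u

/-- The `Z^α` norm `sup_{t ≥ 0} e^{t/8} ‖S(t)u⃗‖_{𝓒^α}`. -/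
def ZNorm (α : ℝ) (u : VDistr) : ℝ≥0∞ :=
  ⨆ t : ℝ≥0, ENNReal.ofReal (Real.exp ((t : ℝ) / 8)) * CvNorm α (Sprop (t : ℝ) u)

/-- Trigonometric polynomials: pairs with finitely many nonzero Fourier coefficients. -/
def IsTrigPoly (u : VDistr) : Prop :=
  (Function.support u.1).Finite ∧ (Function.support u.2).Finite

/-- Membership in `X^α` (the closure of trigonometric polynomials in the `X^α` norm). -/
def memX (α : ℝ) (u : VDistr) : Prop :=
  ∀ ε : ℝ≥0∞, 0 < ε → ∃ v : VDistr, IsTrigPoly v ∧ XNorm α (u - v) < ε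

/-- Membership in `Z^α` (the closure of trigonometric polynomials in the `Z^α` norm). -/
def memZ (α : ℝ) (u : VDistr) : Prop :=
  ∀ ε : ℝ≥0∞, 0 < ε → ∃ v : VDistr, IsTrigPoly v ∧ ZNorm α (u - v) < ε

/-- Continuity of a path with respect to the `Z^α` norm, on `[0, ∞)`. -/
def ZCont (α : ℝ) (f : ℝ → VDistr) : Prop :=
  ∀ t : ℝ, 0 ≤ t → ∀ ε : ℝ≥0∞, 0 < ε → ∃ δ : ℝ, 0 < δ ∧
    ∀ t' : ℝ, 0 ≤ t' → |t' - t| < δ → ZNorm α (f t' - f t) < ε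

/-- Continuity of a path on `[0,T]` with respect to the `H^β × H^{β-1}` norm,
together with finiteness of the norm. -/
def HContOn (β T : ℝ) (f : ℝ → VDistr) : Prop :=
  (∀ t ∈ Set.Icc (0 : ℝ) T, HvNorm β (f t) ≠ ⊤) ∧
  ∀ t ∈ Set.Icc (0 : ℝ) T, ∀ ε : ℝ≥0∞, 0 < ε → ∃ δ : ℝ, 0 < δ ∧
    ∀ t' ∈ Set.Icc (0 : ℝ) T, |t' - t| < δ → HvNorm β (f t' - f t) < ε

/-- `σ_N = ∑_{|n|_∞ ≤ N} ⟨n⟩^{-2}`. -/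
def sigmaN (N : ℕ) : ℝ :=
  ∑' n : Freq, Set.indicator (sqSet (N : ℕ∞)) (fun m => jap m ^ (-2 : ℝ)) n

/-- The renormalised square `Q_{s,N}(u) = (⟨∇⟩^s Π_{≤N} u)² - σ_N`. -/
def QsN (s : ℝ) (N : ℕ) (u : Distr) : Distr :=
  fun n => dmul (japMul s (proj (N : ℕ∞) u)) (japMul s (proj (N : ℕ∞) u)) n
    - (if n = 0 then (Complex.ofReal (sigmaN N)) else 0)

/-- The integral over `𝕋²` of (the function represented by) a distribution. -/
def intT2 (f : Distr) : ℝ := (2 * Real.pi) ^ 2 * (f 0).re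

/-- The `L²(𝕋²)` pairing of two (real-valued) distributions. -/
def pairL2 (f g : Distr) : ℝ := (2 * Real.pi) ^ 2 * (∑' n : Freq, f n * (starRingEnd ℂ) (g n)).re

/-- The renormalised potential
`R_{s,N}(u) = (3/2) ∫ Q_{s,N}(u) (Π_{≤N}u)² + (1/4) ∫ (Π_{≤N}u)⁴`. -/
def RsN (s : ℝ) (N : ℕ) (u : Distr) : ℝ :=
  (3 / 2) * intT2 (dmul (QsN s N u) (dmul (proj (N : ℕ∞) u) (proj (N : ℕ∞) u)))
  + (1 / 4) * intT2 (dmul (dmul (proj (N : ℕ∞) u) (proj (N : ℕ∞) u))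
      (dmul (proj (N : ℕ∞) u) (proj (N : ℕ∞) u)))

/-- `Q_s(u)` exists and equals `Q` in the sense of convergence of `Q_{s,N}(u)` in `H^{α-s}`. -/
def QsLim (s α : ℝ) (u Q : Distr) : Prop :=
  Tendsto (fun N : ℕ => sobNorm (α - s) (QsN s N u - Q)) atTop (nhds 0)

end SDNLW

namespace SDNLW

/-- The `ℓ²` norm of the Fourier coefficients. -/
def l2 (f : Distr) : ℝ≥0∞ := eLpNorm f 2 Measure.count

lemma l2_eq (f : Distr) : l2 f = (∑' n, ‖f n‖ₑ ^ 2) ^ (1 / 2 : ℝ) := by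
  rw [l2, eLpNorm_eq_lintegral_rpow_enorm_toReal (by norm_num) (by norm_num), lintegral_count]
  simp

lemma sobNorm_eq_l2 (s : ℝ) (f : Distr) : sobNorm s f = l2 (japMul s f) := by
  rw [l2_eq, sobNorm]
  congr 2
  ext n
  have hj : 0 ≤ jap n := Real.sqrt_nonneg _
  have h : ‖japMul s f n‖ₑ = ENNReal.ofReal (jap n ^ s) * ‖f n‖ₑ := by
    rw [japMul, enorm_mul, ← ofReal_norm, Complex.norm_real, Real.norm_of_nonneg
      (Real.rpow_nonneg hj s)]
  rw [h, mul_pow, ← ENNReal.ofReal_pow (Real.rpow_nonneg hj s), ← Real.rpow_natCast,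
    ← Real.rpow_mul hj, mul_comm, mul_comm s]
  rfl

lemma l2_add_le (f g : Distr) : l2 (f + g) ≤ l2 f + l2 g :=
  eLpNorm_add_le (Measurable.of_discrete).aestronglyMeasurable
    (Measurable.of_discrete).aestronglyMeasurable (by norm_num)

lemma l2_sum_le {ι : Type*} (t : Finset ι) (f : ι → Distr) :
    l2 (∑ i ∈ t, f i) ≤ ∑ i ∈ t, l2 (f i) :=
  eLpNorm_sum_le (fun _ _ => (Measurable.of_discrete).aestronglyMeasurable) (by norm_num)

lemma l2_mono {f g : Distr} (h : ∀ n, ‖f n‖ ≤ ‖g n‖) : l2 f ≤ l2 g := eLpNorm_mono h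

lemma l2_smul (c : ℂ) (f : Distr) : l2 (c • f) = ‖c‖ₑ * l2 f := eLpNorm_const_smul _ _ _ _

lemma l2_sub_comm (f g : Distr) : l2 (f - g) = l2 (g - f) := eLpNorm_sub_comm _ _ _ _

/-- Lower semicontinuity of the `ℓ²` norm under pointwise convergence. -/
lemma l2_le_of_tendsto {F : ℕ → Distr} {f : Distr} {c : ℝ≥0∞}
    (h : ∀ n, Tendsto (fun k => F k n) atTop (nhds (f n))) (hc : ∀ᶠ k in atTop, l2 (F k) ≤ c) :
    l2 f ≤ c := by
  refine (Lp.eLpNorm_lim_le_liminf_eLpNorm (μ := Measure.count) (p := 2)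
    (fun k => (Measurable.of_discrete (f := F k)).aestronglyMeasurable) f
    (Eventually.of_forall h)).trans ?_
  exact liminf_le_of_frequently_le' hc.frequently

lemma tsum_enorm_mul_le (f g : Distr) (n : Freq) :
    ∑' m, ‖f m‖ₑ * ‖g (n - m)‖ₑ ≤ l2 f * l2 g := by
  have h := ENNReal.lintegral_mul_le_Lp_mul_Lq (Measure.count : Measure Freq)
    Real.HolderConjugate.two_two (f := fun m => ‖f m‖ₑ) (g := fun m => ‖g (n - m)‖ₑ)
    (Measurable.of_discrete).aemeasurable (Measurable.of_discrete).aemeasurable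
  simp only [lintegral_count, Pi.mul_apply, ENNReal.rpow_two] at h
  refine h.trans_eq ?_
  rw [l2_eq, l2_eq, ← (Equiv.subLeft n).tsum_eq (fun m => ‖g m‖ₑ ^ 2)]
  rfl

lemma enorm_dmul_le (f g : Distr) (n : Freq) : ‖dmul f g n‖ₑ ≤ l2 f * l2 g := by
  refine le_trans ?_ (tsum_enorm_mul_le f g n)
  exact enorm_tsum_le_tsum_enorm.trans_eq (by simp only [enorm_mul])

lemma summable_norm_mul {f g : Distr} (hf : l2 f ≠ ⊤) (hg : l2 g ≠ ⊤) (n : Freq) :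
    Summable fun m => ‖f m‖ * ‖g (n - m)‖ := by
  have h := ne_top_of_le_ne_top (ENNReal.mul_ne_top hf hg) (tsum_enorm_mul_le f g n)
  have := ENNReal.summable_toReal h
  simpa using this

/-- The uniform probability measure on `(0, 2π]`. -/
def circleMeasure : Measure ℝ :=
  (ENNReal.ofReal (2 * Real.pi))⁻¹ • volume.restrict (Set.Ioc 0 (2 * Real.pi))

instance : IsProbabilityMeasure circleMeasure := by
  constructor
  have : ENNReal.ofReal (2 * Real.pi) ≠ 0 := by
    simp [Real.pi_pos]
  simp only [circleMeasure, Measure.smul_apply, Measure.restrict_apply_univ, Real.volume_Ioc,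
    sub_zero, smul_eq_mul]
  exact ENNReal.inv_mul_cancel this ENNReal.ofReal_ne_top

/-- The uniform probability measure on `(0, 2π]²`. -/
def torusMeasure : Measure (ℝ × ℝ) := circleMeasure.prod circleMeasure

instance : IsProbabilityMeasure torusMeasure := by unfold torusMeasure; infer_instance

lemma integral_circle_exp (k : ℤ) :
    ∫ x, Complex.exp (Complex.I * (k * x)) ∂circleMeasure = if k = 0 then 1 else 0 := by
  split_ifs with hk
  · simp [hk]
  · have h2 : (Complex.I * k : ℂ) ≠ 0 := by simp [hk]
    rw [circleMeasure, integral_smul_measure,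
      ← intervalIntegral.integral_of_le Real.two_pi_pos.le]
    simp_rw [← mul_assoc]
    rw [integral_exp_mul_complex h2]
    have : Complex.exp (Complex.I * k * ((2 * Real.pi : ℝ) : ℂ)) = 1 := by
      rw [Complex.exp_eq_one_iff]
      exact ⟨k, by push_cast; ring⟩
    rw [this]
    simp

/-- The character `x ↦ e^{i n · x}`. -/
def chr (n : Freq) (x : ℝ × ℝ) : ℂ :=
  Complex.exp (Complex.I * Complex.ofReal ((n.1 : ℝ) * x.1 + (n.2 : ℝ) * x.2))

lemma chr_add (m n : Freq) (x : ℝ × ℝ) : chr (m + n) x = chr m x * chr n x := by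
  rw [chr, chr, chr, ← Complex.exp_add]
  congr 1
  push_cast [Prod.fst_add, Prod.snd_add]
  ring

lemma conj_chr (n : Freq) (x : ℝ × ℝ) : (starRingEnd ℂ) (chr n x) = chr (-n) x := by
  rw [chr, chr, ← Complex.exp_conj]
  congr 1
  simp
  ring

lemma continuous_chr (n : Freq) : Continuous (chr n) := by
  unfold chr; fun_prop

lemma norm_chr (n : Freq) (x : ℝ × ℝ) : ‖chr n x‖ = 1 := by
  rw [chr, mul_comm, Complex.norm_exp_ofReal_mul_I]

lemma integral_chr (n : Freq) : ∫ x, chr n x ∂torusMeasure = if n = 0 then 1 else 0 := by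
  have h : ∀ x : ℝ × ℝ, chr n x =
      Complex.exp (Complex.I * (n.1 * x.1)) * Complex.exp (Complex.I * (n.2 * x.2)) := by
    intro x
    rw [chr, ← Complex.exp_add]
    congr 1
    push_cast
    ring
  simp_rw [h]
  rw [torusMeasure, integral_prod_mul (fun x : ℝ => Complex.exp (Complex.I * (n.1 * x)))
    (fun x : ℝ => Complex.exp (Complex.I * (n.2 * x))), integral_circle_exp, integral_circle_exp]
  rcases n with ⟨a, b⟩
  by_cases ha : a = 0 <;> by_cases hb : b = 0 <;> simp [ha, hb]

lemma integrable_chr (n : Freq) : Integrable (chr n) torusMeasure :=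
  Integrable.of_bound (continuous_chr n).aestronglyMeasurable 1
    (Eventually.of_forall fun x => (norm_chr n x).le)

/-- Finitely supported families of Fourier coefficients. -/
abbrev Fin0 (f : Distr) : Prop := (Function.support f).Finite

lemma eval_def (f : Distr) (x : ℝ × ℝ) : eval f x = ∑' n, f n * chr n x := rfl

lemma Fin0.support_mul {f : Distr} (hf : Fin0 f) (c : Freq → ℂ) :
    (Function.support fun n => f n * c n).Finite :=
  hf.subset (Function.support_mul_subset_left _ _)

lemma Fin0.eval_eq {f : Distr} (hf : Fin0 f) :
    eval f = fun x => ∑ n ∈ hf.toFinset, f n * chr n x := by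
  ext x
  rw [eval_def, tsum_eq_sum]
  intro n hn
  simp at hn
  simp [hn]

lemma Fin0.continuous_eval {f : Distr} (hf : Fin0 f) : Continuous (eval f) := by
  rw [hf.eval_eq]
  exact continuous_finsetSum _ fun n _ => continuous_const.mul (continuous_chr n)

lemma Fin0.integral_eval {f : Distr} (hf : Fin0 f) : ∫ x, eval f x ∂torusMeasure = f 0 := by
  rw [hf.eval_eq, integral_finsetSum _ fun n _ => (integrable_chr n).const_mul _]
  simp_rw [integral_const_mul, integral_chr]
  simp [Finset.sum_ite_eq', eq_comm]

lemma Fin0.add {f g : Distr} (hf : Fin0 f) (hg : Fin0 g) : Fin0 (f + g) :=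
  (hf.union hg).subset (Function.support_add _ _)

lemma Fin0.sub {f g : Distr} (hf : Fin0 f) (hg : Fin0 g) : Fin0 (f - g) :=
  (hf.union hg).subset (Function.support_sub _ _)

lemma Fin0.smul {f : Distr} (c : ℂ) (hf : Fin0 f) : Fin0 (c • f) :=
  hf.subset (Function.support_const_smul_subset _ _)

lemma exists_add_of_dmul_ne_zero {f g : Distr} {n : Freq} (h : dmul f g n ≠ 0) :
    ∃ a b, f a ≠ 0 ∧ g b ≠ 0 ∧ a + b = n := by
  by_contra! hc
  apply h
  rw [dmul, ← tsum_zero (α := ℂ) (β := Freq)]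
  congr 1
  ext m
  by_contra h'
  exact hc m (n - m) (left_ne_zero_of_mul h') (right_ne_zero_of_mul h') (by simp)

lemma Fin0.dmul {f g : Distr} (hf : Fin0 f) (hg : Fin0 g) : Fin0 (dmul f g) := by
  refine (hf.image2 (· + ·) hg).subset fun n hn => ?_
  obtain ⟨a, b, ha, hb, rfl⟩ := exists_add_of_dmul_ne_zero hn
  exact ⟨a, ha, b, hb, rfl⟩

lemma Fin0.eval_add {f g : Distr} (hf : Fin0 f) (hg : Fin0 g) (x : ℝ × ℝ) :
    eval (f + g) x = eval f x + eval g x := by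
  simp only [eval_def, Pi.add_apply, add_mul]
  exact (summable_of_hasFiniteSupport (hf.support_mul _)).tsum_add
    (summable_of_hasFiniteSupport (hg.support_mul _))

lemma Fin0.eval_sub {f g : Distr} (hf : Fin0 f) (hg : Fin0 g) (x : ℝ × ℝ) :
    eval (f - g) x = eval f x - eval g x := by
  simp only [eval_def, Pi.sub_apply, sub_mul]
  exact (summable_of_hasFiniteSupport (hf.support_mul _)).tsum_sub
    (summable_of_hasFiniteSupport (hg.support_mul _))

lemma eval_smul (c : ℂ) (f : Distr) (x : ℝ × ℝ) : eval (c • f) x = c * eval f x := by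
  simp only [eval_def, Pi.smul_apply, smul_eq_mul, mul_assoc, tsum_mul_left]

/-- The shear `(n, m) ↦ (m, n - m)` of pairs of frequencies. -/
def addShear : Freq × Freq ≃ Freq × Freq where
  toFun p := (p.2, p.1 - p.2)
  invFun p := (p.1 + p.2, p.1)
  left_inv p := by simp
  right_inv p := by simp

lemma Fin0.eval_dmul {f g : Distr} (hf : Fin0 f) (hg : Fin0 g) (x : ℝ × ℝ) :
    eval (SDNLW.dmul f g) x = eval f x * eval g x := by
  let F : Freq × Freq → ℂ := fun p => f p.1 * chr p.1 x * (g p.2 * chr p.2 x)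
  have hF : Summable F := by
    apply summable_of_hasFiniteSupport
    refine (hf.prod hg).subset ?_
    rintro ⟨a, b⟩ hab
    exact ⟨left_ne_zero_of_mul (left_ne_zero_of_mul hab),
      left_ne_zero_of_mul (right_ne_zero_of_mul hab)⟩
  have hfs : Summable fun n => f n * chr n x := summable_of_hasFiniteSupport (hf.support_mul _)
  have hgs : Summable fun n => g n * chr n x := summable_of_hasFiniteSupport (hg.support_mul _)
  have h1 : ∑' p, F p = eval f x * eval g x := by
    exact (hfs.tsum_mul_tsum hgs hF).symm
  have hF' : Summable fun p => F (addShear p) := hF.comp_injective addShear.injective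
  rw [← h1, ← addShear.tsum_eq F, hF'.tsum_prod, eval_def]
  refine tsum_congr fun n => ?_
  rw [SDNLW.dmul, ← tsum_mul_right]
  refine tsum_congr fun m => ?_
  have : chr n x = chr m x * chr (n - m) x := by rw [← chr_add]; simp
  simp only [F, addShear, Equiv.coe_fn_mk, this]
  ring

/-- Parseval's identity for trigonometric polynomials. -/
lemma Fin0.parseval {f : Distr} (hf : Fin0 f) :
    ∫⁻ x, ‖eval f x‖ₑ ^ 2 ∂torusMeasure = ∑' n, ‖f n‖ₑ ^ 2 := by
  let g : Distr := fun n => (starRingEnd ℂ) (f (-n))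
  have hg : Fin0 g := by
    have h := hf.preimage (f := fun n : Freq => -n) (neg_injective.injOn)
    refine h.subset fun n hn => ?_
    simpa [g] using hn
  have hgx : ∀ x, eval g x = (starRingEnd ℂ) (eval f x) := by
    intro x
    rw [eval_def, eval_def, Complex.conj_tsum, ← (Equiv.neg Freq).tsum_eq]
    refine tsum_congr fun n => ?_
    simp [g, conj_chr]
  have h1 : ∫ x, ((‖eval f x‖ ^ 2 : ℝ) : ℂ) ∂torusMeasure = ((∑' n, ‖f n‖ ^ 2 : ℝ) : ℂ) := by
    have := (hf.dmul hg).integral_eval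
    simp_rw [hf.eval_dmul hg, hgx, Complex.mul_conj'] at this
    push_cast
    rw [this, SDNLW.dmul]
    refine tsum_congr fun n => ?_
    simp [g, Complex.mul_conj']
  rw [integral_complex_ofReal] at h1
  have h2 : ∫ x, ‖eval f x‖ ^ 2 ∂torusMeasure = ∑' n, ‖f n‖ ^ 2 := by exact_mod_cast h1
  have hs : Summable fun n => ‖f n‖ ^ 2 := by
    apply summable_of_hasFiniteSupport
    exact hf.subset fun n hn => by simpa using hn
  have hint : Integrable (fun x => ‖eval f x‖ ^ 2) torusMeasure := by
    refine Integrable.of_bound (hf.continuous_eval.norm.pow 2).aestronglyMeasurable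
      ((∑ n ∈ hf.toFinset, ‖f n‖) ^ 2) (Eventually.of_forall fun x => ?_)
    rw [norm_pow, norm_norm, hf.eval_eq]
    gcongr
    refine (norm_sum_le _ _).trans_eq ?_
    simp [norm_chr]
  have h3 := congrArg ENNReal.ofReal h2
  rw [ofReal_integral_eq_lintegral_ofReal hint (Eventually.of_forall fun x => by positivity),
    ENNReal.ofReal_tsum_of_nonneg (fun n => by positivity) hs] at h3
  simpa [ENNReal.ofReal_pow] using h3

lemma Fin0.l2_eq_lintegral {f : Distr} (hf : Fin0 f) :
    l2 f = (∫⁻ x, ‖eval f x‖ₑ ^ 2 ∂torusMeasure) ^ (1 / 2 : ℝ) := by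
  rw [hf.parseval, l2_eq]

lemma Fin0.ext_eval {f g : Distr} (hf : Fin0 f) (hg : Fin0 g) (h : ∀ x, eval f x = eval g x) :
    f = g := by
  have h0 := (hf.sub hg).parseval
  simp only [hf.eval_sub hg, h, sub_self, enorm_zero] at h0
  ext n
  have h1 : ∑' n, ‖(f - g) n‖ₑ ^ 2 = 0 := by rw [← h0]; simp
  simpa [sub_eq_zero] using ENNReal.tsum_eq_zero.mp h1 n

lemma enorm_eval_le (f : Distr) (x : ℝ × ℝ) : ‖eval f x‖ₑ ≤ linfNorm f :=
  le_iSup (fun x => (‖eval f x‖₊ : ℝ≥0∞)) x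

lemma linfNorm_le {f : Distr} {c : ℝ≥0∞} (h : ∀ x, ‖eval f x‖ₑ ≤ c) : linfNorm f ≤ c :=
  iSup_le h

lemma Fin0.linfNorm_add_le {f g : Distr} (hf : Fin0 f) (hg : Fin0 g) :
    linfNorm (f + g) ≤ linfNorm f + linfNorm g :=
  linfNorm_le fun x => by
    rw [hf.eval_add hg]
    exact (enorm_add_le _ _).trans (add_le_add (enorm_eval_le f x) (enorm_eval_le g x))

lemma Fin0.l2_dmul_le {f g : Distr} (hf : Fin0 f) (hg : Fin0 g) :
    l2 (SDNLW.dmul f g) ≤ linfNorm f * l2 g := by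
  rw [(hf.dmul hg).l2_eq_lintegral, hg.l2_eq_lintegral]
  have : linfNorm f = (linfNorm f ^ 2) ^ (1 / 2 : ℝ) := by
    rw [← ENNReal.rpow_natCast, ← ENNReal.rpow_mul]; norm_num
  rw [this, ← ENNReal.mul_rpow_of_nonneg _ _ (by norm_num), ← lintegral_const_mul]
  · gcongr with x
    rw [hf.eval_dmul hg, enorm_mul, mul_pow]
    gcongr
    exact enorm_eval_le f x
  · exact (hg.continuous_eval.measurable.enorm.pow_const 2)

lemma Fin0.l2_le_linfNorm {f : Distr} (hf : Fin0 f) : l2 f ≤ linfNorm f := by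
  rw [hf.l2_eq_lintegral]
  have : linfNorm f = (linfNorm f ^ 2) ^ (1 / 2 : ℝ) := by
    rw [← ENNReal.rpow_natCast, ← ENNReal.rpow_mul]; norm_num
  rw [this]
  gcongr
  calc ∫⁻ x, ‖eval f x‖ₑ ^ 2 ∂torusMeasure ≤ ∫⁻ _, linfNorm f ^ 2 ∂torusMeasure := by
        gcongr with x; exact enorm_eval_le f x
    _ = _ := by simp

lemma Fin0.l2_sq_sub_sq_le {f g : Distr} (hf : Fin0 f) (hg : Fin0 g) :
    l2 (SDNLW.dmul f f - SDNLW.dmul g g) ≤ (linfNorm f + linfNorm g) * l2 (f - g) := by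
  have : SDNLW.dmul f f - SDNLW.dmul g g = SDNLW.dmul (f + g) (f - g) := by
    refine ((hf.dmul hf).sub (hg.dmul hg)).ext_eval ((hf.add hg).dmul (hf.sub hg)) fun x => ?_
    rw [(hf.dmul hf).eval_sub (hg.dmul hg), hf.eval_dmul hf, hg.eval_dmul hg,
      (hf.add hg).eval_dmul (hf.sub hg), hf.eval_add hg, hf.eval_sub hg]
    ring
  rw [this]
  refine ((hf.add hg).l2_dmul_le (hf.sub hg)).trans ?_
  gcongr
  exact hf.linfNorm_add_le hg

end SDNLW

namespace SDNLW

lemma fnorm_eq_norm (n : Freq) : fnorm n = ‖(⟨n.1, n.2⟩ : ℂ)‖ := by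
  rw [fnorm, Complex.norm_def, Complex.normSq_mk]
  ring_nf

lemma fnorm_add_le (m n : Freq) : fnorm (m + n) ≤ fnorm m + fnorm n := by
  simp only [fnorm_eq_norm]
  refine le_of_eq_of_le ?_ (norm_add_le _ _)
  congr 1
  apply Complex.ext <;> simp

lemma finite_fnorm_le (R : ℝ) : {n : Freq | fnorm n ≤ R}.Finite := by
  refine ((Set.finite_Icc (-⌈R⌉) ⌈R⌉).prod (Set.finite_Icc (-⌈R⌉) ⌈R⌉)).subset ?_
  rintro ⟨a, b⟩ h
  rw [Set.mem_ofPred_eq, fnorm_eq_norm] at h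
  have h1 := abs_le.mp ((Complex.abs_re_le_norm _).trans (h.trans (Int.le_ceil R)))
  have h2 := abs_le.mp ((Complex.abs_im_le_norm _).trans (h.trans (Int.le_ceil R)))
  dsimp only at h1 h2
  norm_cast at h1 h2

/-- `f` has no frequencies of length more than `R`. -/
def SuppLE (f : Distr) (R : ℝ) : Prop := ∀ n, f n ≠ 0 → fnorm n ≤ R

lemma SuppLE.fin0 {f : Distr} {R : ℝ} (h : SuppLE f R) : Fin0 f := (finite_fnorm_le R).subset h

lemma SuppLE.mono {f : Distr} {R R' : ℝ} (h : SuppLE f R) (hR : R ≤ R') : SuppLE f R' :=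
  fun n hn => (h n hn).trans hR

lemma SuppLE.add {f g : Distr} {R : ℝ} (hf : SuppLE f R) (hg : SuppLE g R) :
    SuppLE (f + g) R := fun n hn => by
  by_cases h : f n = 0
  · exact hg n fun h' => hn (by simp [h, h'])
  · exact hf n h

lemma SuppLE.sub {f g : Distr} {R : ℝ} (hf : SuppLE f R) (hg : SuppLE g R) :
    SuppLE (f - g) R := fun n hn => by
  by_cases h : f n = 0
  · exact hg n fun h' => hn (by simp [h, h'])
  · exact hf n h

lemma SuppLE.smul {f : Distr} {R : ℝ} (c : ℂ) (hf : SuppLE f R) : SuppLE (c • f) R :=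
  fun n hn => hf n (right_ne_zero_of_mul hn)

lemma SuppLE.dmul {f g : Distr} {R R' : ℝ} (hf : SuppLE f R) (hg : SuppLE g R') :
    SuppLE (dmul f g) (R + R') := fun n hn => by
  obtain ⟨a, b, ha, hb, rfl⟩ := exists_add_of_dmul_ne_zero hn
  exact (fnorm_add_le a b).trans (add_le_add (hf a ha) (hg b hb))

lemma jap_le (n : Freq) : jap n ≤ 1 + fnorm n := by
  have h : (0 : ℝ) ≤ (n.1 : ℝ) ^ 2 + (n.2 : ℝ) ^ 2 := by positivity
  rw [jap, fnorm]
  apply Real.sqrt_le_iff.mpr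
  have := Real.sqrt_nonneg ((n.1 : ℝ) ^ 2 + (n.2 : ℝ) ^ 2)
  constructor
  · positivity
  · nlinarith [Real.sq_sqrt h]

/-- A Bernstein-type bound for the Sobolev norm. -/
lemma sobNorm_le_of_suppLE {s : ℝ} (hs : 0 < s) {f : Distr} {k : ℕ}
    (hf : SuppLE f (4 * 2 ^ k)) :
    sobNorm s f ≤ ENNReal.ofReal (8 ^ s) * ENNReal.ofReal (2 ^ s) ^ k * l2 f := by
  have hc : (0 : ℝ) ≤ 8 ^ s * (2 ^ s) ^ k := by positivity
  rw [sobNorm_eq_l2, ← ENNReal.ofReal_pow (by positivity), ← ENNReal.ofReal_mul (by positivity)]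
  have h2 : ENNReal.ofReal (8 ^ s * (2 ^ s) ^ k) = ‖((8 ^ s * (2 ^ s) ^ k : ℝ) : ℂ)‖ₑ := by
    rw [← ofReal_norm, Complex.norm_real, Real.norm_of_nonneg hc]
  rw [h2, ← l2_smul]
  refine l2_mono fun n => ?_
  have hj : 0 ≤ jap n := Real.sqrt_nonneg _
  rw [japMul, Pi.smul_apply, smul_eq_mul, norm_mul, norm_mul, Complex.norm_real,
    Complex.norm_real, Real.norm_of_nonneg hc, Real.norm_of_nonneg (Real.rpow_nonneg hj s)]
  by_cases hn : f n = 0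
  · simp [hn]
  gcongr
  have h1 : (1 : ℝ) ≤ 2 ^ k := one_le_pow₀ (by norm_num)
  calc jap n ^ s ≤ (8 * 2 ^ k) ^ s :=
        Real.rpow_le_rpow hj (by linarith [jap_le n, hf n hn]) hs.le
    _ = 8 ^ s * (2 ^ s) ^ k := by
        rw [Real.mul_rpow (by norm_num) (by positivity), ← Real.rpow_natCast,
          ← Real.rpow_natCast, ← Real.rpow_mul (by norm_num), ← Real.rpow_mul (by norm_num),
          mul_comm s]

/-- The sum of the first `k` Littlewood–Paley pieces. -/
def lowSum (k : ℕ) (f : Distr) : Distr := ∑ j ∈ Finset.range k, LP j f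

lemma lowSum_succ (k : ℕ) (f : Distr) : lowSum (k + 1) f = lowSum k f + LP k f :=
  Finset.sum_range_succ _ _

/-- The frequencies seen by `lowSum k`. -/
def lowFreq (k : ℕ) : Set Freq := {n | 0 < k ∧ fnorm n ≤ 2 ^ (k - 1)}

lemma lowSum_eq (k : ℕ) (f : Distr) : lowSum k f = (lowFreq k).indicator f := by
  classical
  induction k with
  | zero => ext; simp [lowSum, lowFreq]
  | succ k ih =>
    rw [lowSum_succ, ih]
    ext n
    simp only [LP, lowFreq, Pi.add_apply, Set.indicator_apply, Set.mem_ofPred_eq]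
    rcases k with _ | k
    · simp
    · have h2 : (2 : ℝ) ^ k ≤ 2 ^ (k + 1) := by gcongr <;> norm_num
      by_cases h : fnorm n ≤ 2 ^ k
      · simp [h, h.trans h2]
      · simp [h, not_le.mp h]

lemma norm_lowSum_le (k : ℕ) (f : Distr) (n : Freq) : ‖lowSum k f n‖ ≤ ‖f n‖ := by
  rw [lowSum_eq]; exact norm_indicator_le_norm_self _ _

lemma lowSum_sub (k : ℕ) (f g : Distr) : lowSum k (f - g) = lowSum k f - lowSum k g := by
  simp only [lowSum_eq]; exact Set.indicator_sub' _ _ _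

lemma suppLE_lowSum (k : ℕ) (f : Distr) : SuppLE (lowSum k f) (2 ^ (k - 1)) := fun n hn => by
  rw [lowSum_eq] at hn
  exact (Set.mem_of_indicator_ne_zero hn).2

lemma suppLE_LP (k : ℕ) (f : Distr) : SuppLE (LP k f) (2 ^ k) := fun n hn => by
  have h := Set.mem_of_indicator_ne_zero hn
  rcases k with _ | k
  · simpa using h
  · exact (by simpa using h : _ ∧ _).2

lemma eventually_mem_lowFreq (n : Freq) : ∀ᶠ k in atTop, n ∈ lowFreq k := by
  have h : Tendsto (fun k : ℕ => (2 : ℝ) ^ (k - 1)) atTop atTop :=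
    (tendsto_pow_atTop_atTop_of_one_lt (by norm_num)).comp (tendsto_sub_atTop_nat 1)
  filter_upwards [h.eventually_ge_atTop (fnorm n), eventually_gt_atTop 0] with k h1 h2
  exact ⟨h2, h1⟩

lemma tendsto_lowSum (f : Distr) (n : Freq) :
    Tendsto (fun k => lowSum k f n) atTop (nhds (f n)) := by
  refine tendsto_const_nhds.congr' ?_
  filter_upwards [eventually_mem_lowFreq n] with k hk
  rw [lowSum_eq, Set.indicator_of_mem hk]

lemma tendsto_dmul_lowSum {f g : Distr} {G : ℕ → Distr} (hf : l2 f ≠ ⊤) (hg : l2 g ≠ ⊤)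
    (hG : ∀ n, Tendsto (fun k => G k n) atTop (nhds (g n))) (hGg : ∀ k n, ‖G k n‖ ≤ ‖g n‖)
    (n : Freq) : Tendsto (fun k => dmul (lowSum k f) (G k) n) atTop (nhds (dmul f g n)) := by
  refine tendsto_tsum_of_dominated_convergence (summable_norm_mul hf hg n) (fun m => ?_)
    (Eventually.of_forall fun k m => ?_)
  · exact (tendsto_lowSum f m).mul (hG (n - m))
  · rw [norm_mul]
    exact mul_le_mul (norm_lowSum_le k f m) (hGg k _) (norm_nonneg _) (norm_nonneg _)

lemma dmul_lowSum_LP_eq_zero {f g : Distr} {n : Freq} {k : ℕ} (hk : fnorm n < 2 ^ k) :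
    dmul (lowSum (k + 1) f) (LP (k + 2) g) n = 0 := by
  by_contra h
  obtain ⟨a, b, ha, hb, rfl⟩ := exists_add_of_dmul_ne_zero h
  have h1 : fnorm a ≤ 2 ^ k := suppLE_lowSum _ _ a ha
  have h2 := Set.mem_of_indicator_ne_zero hb
  have h3 : (2 : ℝ) ^ (k + 1) < fnorm b := (by simpa using h2 : _ ∧ _).1
  have hneg : fnorm (-a) = fnorm a := by simp [fnorm]
  have h4 := fnorm_add_le (a + b) (-a)
  rw [add_neg_cancel_comm, hneg] at h4
  rw [pow_succ] at h3
  linarith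

lemma tendsto_sum_para (f g : Distr) (n : Freq) :
    Tendsto (fun K => ∑ k ∈ Finset.range K, dmul (lowPass k f) (LP k g) n) atTop
      (nhds (para f g n)) := by
  apply Summable.tendsto_sum_tsum_nat
  have h : Tendsto (fun k : ℕ => (2 : ℝ) ^ k) atTop atTop :=
    tendsto_pow_atTop_atTop_of_one_lt (by norm_num)
  obtain ⟨k₀, hk₀⟩ := (h.eventually_gt_atTop (fnorm n)).exists_forall_of_atTop
  refine summable_of_hasFiniteSupport ((Set.finite_lt_nat (k₀ + 2)).subset fun k hk => ?_)
  by_contra hlt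
  obtain ⟨j, rfl⟩ := Nat.exists_eq_add_of_le (not_lt.mp hlt)
  apply hk
  have := dmul_lowSum_LP_eq_zero (f := f) (g := g) (hk₀ (k₀ + j) (by omega))
  rw [← this, show k₀ + 2 + j = k₀ + j + 2 by ring]
  rfl

lemma linfNorm_zero : linfNorm 0 = 0 := by
  simp [linfNorm, eval]

section Geometric

variable {u : Distr} {A q : ℝ≥0∞}

lemma linfNorm_lowSum_le (h : ∀ k, linfNorm (LP k u) ≤ A * q ^ k) (k : ℕ) :
    linfNorm (lowSum k u) ≤ A * (1 - q)⁻¹ := by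
  have h1 : linfNorm (lowSum k u) ≤ ∑ j ∈ Finset.range k, A * q ^ j := by
    induction k with
    | zero => simp [lowSum, linfNorm_zero]
    | succ k ih =>
      rw [lowSum_succ, Finset.sum_range_succ]
      exact ((suppLE_lowSum k u).fin0.linfNorm_add_le (suppLE_LP k u).fin0).trans
        (add_le_add ih (h k))
  rw [← Finset.mul_sum] at h1
  rw [← ENNReal.tsum_geometric]
  exact h1.trans (mul_le_mul_right (ENNReal.sum_le_tsum _) _)

lemma l2_lowSum_sub_le (h : ∀ k, linfNorm (LP k u) ≤ A * q ^ k) {k L : ℕ} (hkL : k ≤ L) :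
    l2 (lowSum L u - lowSum k u) ≤ A * (1 - q)⁻¹ * q ^ k := by
  obtain ⟨j, rfl⟩ := Nat.exists_eq_add_of_le hkL
  rw [lowSum, lowSum, Finset.sum_range_add, add_sub_cancel_left]
  calc _ ≤ ∑ i ∈ Finset.range j, l2 (LP (k + i) u) := l2_sum_le _ _
    _ ≤ ∑ i ∈ Finset.range j, A * q ^ k * q ^ i := by
        refine Finset.sum_le_sum fun i _ => ?_
        rw [mul_assoc, ← pow_add]
        exact (suppLE_LP _ u).fin0.l2_le_linfNorm.trans (h _)
    _ ≤ A * q ^ k * (1 - q)⁻¹ := by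
        rw [← Finset.mul_sum, ← ENNReal.tsum_geometric]
        exact mul_le_mul_right (ENNReal.sum_le_tsum _) _
    _ = _ := by ring

lemma l2_le_of_LP (h : ∀ k, linfNorm (LP k u) ≤ A * q ^ k) : l2 u ≤ A * (1 - q)⁻¹ :=
  l2_le_of_tendsto (tendsto_lowSum u) (Eventually.of_forall fun k =>
    ((suppLE_lowSum k u).fin0.l2_le_linfNorm).trans (linfNorm_lowSum_le h k))

lemma l2_sq_lowSum_sub_sq_lowSum_le (h : ∀ k, linfNorm (LP k u) ≤ A * q ^ k) {k L : ℕ}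
    (hkL : k ≤ L) :
    l2 (dmul (lowSum L u) (lowSum L u) - dmul (lowSum k u) (lowSum k u)) ≤
      2 * (A * (1 - q)⁻¹) ^ 2 * q ^ k := by
  refine ((suppLE_lowSum L u).fin0.l2_sq_sub_sq_le (suppLE_lowSum k u).fin0).trans ?_
  calc _ ≤ (A * (1 - q)⁻¹ + A * (1 - q)⁻¹) * (A * (1 - q)⁻¹ * q ^ k) := by
        gcongr
        · exact linfNorm_lowSum_le h L
        · exact linfNorm_lowSum_le h k
        · exact l2_lowSum_sub_le h hkL
    _ = _ := by ring

lemma l2_sq_sub_sq_lowSum_le (h : ∀ k, linfNorm (LP k u) ≤ A * q ^ k) (hu : l2 u ≠ ⊤) (k : ℕ) :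
    l2 (dmul u u - dmul (lowSum k u) (lowSum k u)) ≤ 2 * (A * (1 - q)⁻¹) ^ 2 * q ^ k := by
  refine l2_le_of_tendsto
    (F := fun L => dmul (lowSum L u) (lowSum L u) - dmul (lowSum k u) (lowSum k u))
    (fun n => ?_) ?_
  · exact (tendsto_dmul_lowSum hu hu (tendsto_lowSum u)
      (fun k n => norm_lowSum_le k u n) n).sub tendsto_const_nhds
  · filter_upwards [eventually_ge_atTop k] with L hL
    exact l2_sq_lowSum_sub_sq_lowSum_le h hL

lemma tendsto_cube_lowSum (h : ∀ k, linfNorm (LP k u) ≤ A * q ^ k) (hA : A ≠ ⊤) (hq : q < 1)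
    (n : Freq) : Tendsto (fun K => cube (lowSum K u) n) atTop (nhds (cube u n)) := by
  have hB : A * (1 - q)⁻¹ ≠ ⊤ :=
    ENNReal.mul_ne_top hA (ENNReal.inv_ne_top.mpr (tsub_pos_of_lt hq).ne')
  have hu : l2 u ≠ ⊤ := ne_top_of_le_ne_top hB (l2_le_of_LP h)
  have hu2 : l2 (dmul u u) ≠ ⊤ := by
    have h0 := l2_sq_sub_sq_lowSum_le h hu 0
    have : dmul (lowSum 0 u) (lowSum 0 u) = 0 := by ext; simp [dmul, lowSum]
    rw [this, sub_zero] at h0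
    exact ne_top_of_le_ne_top (by finiteness) h0
  have h1 : Tendsto (fun K => dmul (lowSum K u) (dmul u u) n) atTop (nhds (cube u n)) :=
    tendsto_dmul_lowSum (G := fun _ => dmul u u) hu hu2 (fun _ => tendsto_const_nhds)
      (fun _ _ => le_rfl) n
  have h2 : Tendsto (fun K => dmul (lowSum K u)
      (dmul (lowSum K u) (lowSum K u) - dmul u u) n) atTop (nhds 0) := by
    rw [tendsto_zero_iff_enorm_tendsto_zero]
    have h3 : Tendsto (fun k : ℕ => (A * (1 - q)⁻¹) * (2 * (A * (1 - q)⁻¹) ^ 2 * q ^ k)) atTop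
        (nhds 0) := by
      have := ENNReal.Tendsto.const_mul (ENNReal.tendsto_pow_atTop_nhds_zero_of_lt_one hq)
        (Or.inr (show A * (1 - q)⁻¹ * (2 * (A * (1 - q)⁻¹) ^ 2) ≠ ⊤ by finiteness))
      simpa only [mul_zero, mul_assoc] using this
    refine tendsto_of_tendsto_of_tendsto_of_le_of_le tendsto_const_nhds h3 (fun _ => zero_le)
      fun k => ?_
    refine (enorm_dmul_le _ _ n).trans (mul_le_mul' ?_ ?_)
    · exact ((suppLE_lowSum k u).fin0.l2_le_linfNorm).trans (linfNorm_lowSum_le h k)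
    · rw [l2_sub_comm]
      exact l2_sq_sub_sq_lowSum_le h hu k
  have h4 := h2.add h1
  rw [zero_add] at h4
  refine h4.congr fun K => ?_
  have hfin : ∀ w : Distr, Summable fun m => lowSum K u m * w (n - m) := fun w =>
    summable_of_hasFiniteSupport ((suppLE_lowSum K u).fin0.support_mul _)
  simp only [cube]
  rw [dmul, dmul, dmul, ← (hfin _).tsum_add (hfin _)]
  refine tsum_congr fun m => ?_
  simp only [Pi.sub_apply]
  ring

end Geometric

end SDNLW

namespace SDNLW

/-- The piece of `u³ - 3 (u² ≺ u)` whose highest input frequency is of size `2 ^ k`. -/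
def remainderPiece (u : Distr) (k : ℕ) : Distr :=
  (3 : ℂ) • dmul (LP k u) (dmul (lowSum k u) (lowSum k u) - lowSum (k - 1) (dmul u u))
    + (3 : ℂ) • dmul (lowSum k u) (dmul (LP k u) (LP k u))
    + dmul (LP k u) (dmul (LP k u) (LP k u))

lemma sum_remainderPiece (u : Distr) (K : ℕ) :
    ∑ k ∈ Finset.range K, remainderPiece u k = cube (lowSum K u) -
      (3 : ℂ) • ∑ k ∈ Finset.range K, dmul (lowPass k (dmul u u)) (LP k u) := by
  induction K with
  | zero => ext; simp [cube, dmul, lowSum]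
  | succ K ih =>
    rw [Finset.sum_range_succ, ih, Finset.sum_range_succ, smul_add, lowSum_succ, ← sub_sub,
      sub_add_eq_add_sub, eq_comm]
    have hS := (suppLE_lowSum K u).fin0
    have ha := (suppLE_LP K u).fin0
    have hQ := (suppLE_lowSum (K - 1) (dmul u u)).fin0
    have key : cube (lowSum K u + LP K u) - (3 : ℂ) • dmul (lowSum (K - 1) (dmul u u)) (LP K u)
        = cube (lowSum K u) + remainderPiece u K := by
      have hSa := hS.add ha
      have hc1 := hSa.dmul (hSa.dmul hSa)
      have hc2 := hS.dmul (hS.dmul hS)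
      have hQa := (hQ.dmul ha).smul 3
      have hd := (hS.dmul hS).sub hQ
      have ht1 := (ha.dmul hd).smul 3
      have ht2 := (hS.dmul (ha.dmul ha)).smul 3
      have ht3 := ha.dmul (ha.dmul ha)
      refine (hc1.sub hQa).ext_eval (hc2.add ((ht1.add ht2).add ht3)) fun x => ?_
      simp only [cube, remainderPiece]
      rw [hc1.eval_sub hQa, hc2.eval_add ((ht1.add ht2).add ht3),
        (ht1.add ht2).eval_add ht3, ht1.eval_add ht2, eval_smul, eval_smul, eval_smul,
        hSa.eval_dmul (hSa.dmul hSa), hSa.eval_dmul hSa, hS.eval_add ha, hQ.eval_dmul ha,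
        hS.eval_dmul (hS.dmul hS), hS.eval_dmul hS, ha.eval_dmul hd, (hS.dmul hS).eval_sub hQ,
        hS.eval_dmul hS, hS.eval_dmul (ha.dmul ha), ha.eval_dmul (ha.dmul ha), ha.eval_dmul ha]
      ring
    rw [← sub_eq_iff_eq_add] at key
    rw [← key, lowPass, lowSum, lowSum]
    abel

lemma suppLE_remainderPiece (u : Distr) (k : ℕ) : SuppLE (remainderPiece u k) (4 * 2 ^ k) := by
  have h1 : (2 : ℝ) ^ (k - 1) ≤ 2 ^ k := pow_le_pow_right₀ (by norm_num) (by omega)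
  have h2 : (2 : ℝ) ^ (k - 1 - 1) ≤ 2 ^ k := pow_le_pow_right₀ (by norm_num) (by omega)
  have h0 : (0 : ℝ) < 2 ^ k := by positivity
  have hS := (suppLE_lowSum k u).mono h1
  have ha := suppLE_LP k u
  have hQ := (suppLE_lowSum (k - 1) (dmul u u)).mono (show _ ≤ (2 : ℝ) ^ k + 2 ^ k by linarith)
  refine SuppLE.add (SuppLE.add ?_ ?_) ?_
  · exact ((ha.dmul ((hS.dmul hS).sub hQ)).smul 3).mono (by linarith)
  · exact ((hS.dmul (ha.dmul ha)).smul 3).mono (by linarith)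
  · exact (ha.dmul (ha.dmul ha)).mono (by linarith)

/-- The high frequencies of `(S_k u)²` only see the top two Littlewood–Paley pieces. -/
lemma l2_sq_sub_lowSum_le (u : Distr) (k : ℕ) :
    l2 (dmul (lowSum k u) (lowSum k u) - lowSum (k - 1) (dmul (lowSum k u) (lowSum k u))) ≤
      l2 (dmul (lowSum k u) (lowSum k u) - dmul (lowSum (k - 2) u) (lowSum (k - 2) u)) := by
  refine l2_mono fun n => ?_
  rw [lowSum_eq (k - 1), Pi.sub_apply, Pi.sub_apply]
  by_cases hn : n ∈ lowFreq (k - 1)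
  · rw [Set.indicator_of_mem hn, sub_self, norm_zero]
    exact norm_nonneg _
  · rw [Set.indicator_of_notMem hn]
    have : dmul (lowSum (k - 2) u) (lowSum (k - 2) u) n = 0 := by
      by_contra h
      apply hn
      obtain ⟨a, b, ha, hb, rfl⟩ := exists_add_of_dmul_ne_zero h
      rw [lowSum_eq] at ha hb
      obtain ⟨hk, ha⟩ := Set.mem_of_indicator_ne_zero ha
      obtain ⟨-, hb⟩ := Set.mem_of_indicator_ne_zero hb
      refine ⟨by omega, (fnorm_add_le a b).trans ?_⟩
      rw [show k - 1 - 1 = k - 2 - 1 + 1 by omega, pow_succ]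
      linarith
    rw [this]

section Geometric

variable {u : Distr} {A q : ℝ≥0∞}

lemma pow_sub_two_le (hq : q < 1) (hq0 : q ≠ 0) (k : ℕ) : q ^ (k - 2) ≤ (q ^ 2)⁻¹ * q ^ k := by
  have h2 : q ^ 2 ≠ ⊤ := ENNReal.pow_ne_top hq.ne_top
  calc q ^ (k - 2) = (q ^ 2)⁻¹ * q ^ (k - 2 + 2) := by
        rw [pow_add, mul_comm (q ^ (k - 2)), ← mul_assoc,
          ENNReal.inv_mul_cancel (pow_ne_zero 2 hq0) h2, one_mul]
    _ ≤ (q ^ 2)⁻¹ * q ^ k :=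
        mul_le_mul_right (pow_le_pow_right_of_le_one' hq.le (by omega)) _

lemma l2_sq_sub_lowSum_sq_le (h : ∀ k, linfNorm (LP k u) ≤ A * q ^ k) (hu : l2 u ≠ ⊤)
    (hq : q < 1) (hq0 : q ≠ 0) (k : ℕ) :
    l2 (dmul (lowSum k u) (lowSum k u) - lowSum (k - 1) (dmul u u)) ≤
      2 * (A * (1 - q)⁻¹) ^ 2 * ((q ^ 2)⁻¹ + 1) * q ^ k := by
  have hsplit : dmul (lowSum k u) (lowSum k u) - lowSum (k - 1) (dmul u u) =
      (dmul (lowSum k u) (lowSum k u) - lowSum (k - 1) (dmul (lowSum k u) (lowSum k u)))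
      + lowSum (k - 1) (dmul (lowSum k u) (lowSum k u) - dmul u u) := by
    rw [lowSum_sub]; abel
  rw [hsplit]
  refine (l2_add_le _ _).trans ?_
  calc _ ≤ 2 * (A * (1 - q)⁻¹) ^ 2 * ((q ^ 2)⁻¹ * q ^ k) + 2 * (A * (1 - q)⁻¹) ^ 2 * q ^ k := by
        refine add_le_add ?_ ?_
        · refine (l2_sq_sub_lowSum_le u k).trans
            ((l2_sq_lowSum_sub_sq_lowSum_le h (Nat.sub_le k 2)).trans ?_)
          exact mul_le_mul_right (pow_sub_two_le hq hq0 k) _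
        · refine (l2_mono (norm_lowSum_le _ _)).trans ?_
          rw [l2_sub_comm]
          exact l2_sq_sub_sq_lowSum_le h hu k
    _ = _ := by ring

lemma l2_remainderPiece_le (h : ∀ k, linfNorm (LP k u) ≤ A * q ^ k) (hu : l2 u ≠ ⊤)
    (hq : q < 1) (hq0 : q ≠ 0) (k : ℕ) :
    l2 (remainderPiece u k) ≤
      (6 * (1 - q)⁻¹ ^ 2 * ((q ^ 2)⁻¹ + 1) + 3 * (1 - q)⁻¹ + 1) * A ^ 3 * (q ^ 2) ^ k := by
  have hS := (suppLE_lowSum k u).fin0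
  have ha := (suppLE_LP k u).fin0
  have hQ := (suppLE_lowSum (k - 1) (dmul u u)).fin0
  have ha2 : l2 (dmul (LP k u) (LP k u)) ≤ (A * q ^ k) * (A * q ^ k) :=
    (ha.l2_dmul_le ha).trans (mul_le_mul' (h k) (ha.l2_le_linfNorm.trans (h k)))
  have h1 := (ha.l2_dmul_le ((hS.dmul hS).sub hQ)).trans
    (mul_le_mul' (h k) (l2_sq_sub_lowSum_sq_le h hu hq hq0 k))
  have h2 := (hS.l2_dmul_le (ha.dmul ha)).trans (mul_le_mul' (linfNorm_lowSum_le h k) ha2)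
  have h3 := (ha.l2_dmul_le (ha.dmul ha)).trans (mul_le_mul' (h k) ha2)
  have e3 : ‖(3 : ℂ)‖ₑ = 3 := by
    rw [← ofReal_norm]; simp
  refine (l2_add_le _ _).trans ((add_le_add_left (l2_add_le _ _) _).trans ?_)
  rw [l2_smul, l2_smul, e3]
  refine (add_le_add (add_le_add (mul_le_mul_right h1 3) (mul_le_mul_right h2 3)) h3).trans ?_
  have hqk : q ^ k ≤ 1 := pow_le_one' hq.le k
  calc _ = (6 * (1 - q)⁻¹ ^ 2 * ((q ^ 2)⁻¹ + 1) + 3 * (1 - q)⁻¹) * A ^ 3 * (q ^ 2) ^ k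
        + A ^ 3 * (q ^ 2) ^ k * q ^ k := by ring
    _ ≤ (6 * (1 - q)⁻¹ ^ 2 * ((q ^ 2)⁻¹ + 1) + 3 * (1 - q)⁻¹) * A ^ 3 * (q ^ 2) ^ k
        + A ^ 3 * (q ^ 2) ^ k * 1 := by gcongr
    _ = _ := by ring

end Geometric

lemma sobNorm_sum_le {ι : Type*} (s : ℝ) (t : Finset ι) (f : ι → Distr) :
    sobNorm s (∑ i ∈ t, f i) ≤ ∑ i ∈ t, sobNorm s (f i) := by
  simp only [sobNorm_eq_l2]
  refine le_of_eq_of_le ?_ (l2_sum_le t _)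
  congr 1
  ext n
  simp [japMul, Finset.mul_sum]

lemma sobNorm_le_of_tendsto {s : ℝ} {F : ℕ → Distr} {f : Distr} {c : ℝ≥0∞}
    (h : ∀ n, Tendsto (fun k => F k n) atTop (nhds (f n))) (hc : ∀ k, sobNorm s (F k) ≤ c) :
    sobNorm s f ≤ c := by
  simp only [sobNorm_eq_l2] at hc ⊢
  exact l2_le_of_tendsto (fun n => (h n).const_mul _) (Eventually.of_forall hc)

lemma linfNorm_LP_le (σ : ℝ) (u : Distr) (k : ℕ) :
    linfNorm (LP k u) ≤ CNorm σ u * ENNReal.ofReal (2 ^ (-σ)) ^ k := by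
  have h : ENNReal.ofReal ((2 : ℝ) ^ ((k : ℝ) * σ)) * linfNorm (LP k u) ≤ CNorm σ u :=
    le_iSup (fun j : ℕ => ENNReal.ofReal ((2 : ℝ) ^ ((j : ℝ) * σ)) * linfNorm (LP j u)) k
  have e : ENNReal.ofReal (2 ^ (-σ)) ^ k * ENNReal.ofReal ((2 : ℝ) ^ ((k : ℝ) * σ)) = 1 := by
    rw [← ENNReal.ofReal_pow (by positivity), ← ENNReal.ofReal_mul (by positivity),
      ← Real.rpow_natCast, ← Real.rpow_mul (by norm_num), ← Real.rpow_add (by norm_num)]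
    simp [mul_comm]
  calc linfNorm (LP k u) = ENNReal.ofReal (2 ^ (-σ)) ^ k *
        (ENNReal.ofReal ((2 : ℝ) ^ ((k : ℝ) * σ)) * linfNorm (LP k u)) := by
        rw [← mul_assoc, e, one_mul]
    _ ≤ _ := by rw [mul_comm (CNorm σ u)]; exact mul_le_mul_right h _

/-- The paracontrolled remainder estimate, with an explicit constant. -/
lemma sobNorm_cube_sub_para_le {s : ℝ} (hs : 0 < s) {u : Distr} {A q : ℝ≥0∞}
    (h : ∀ k, linfNorm (LP k u) ≤ A * q ^ k) (hA : A ≠ ⊤) (hq : q < 1) (hq0 : q ≠ 0) :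
    sobNorm s (cube u - (3 : ℂ) • para (dmul u u) u) ≤
      ENNReal.ofReal (8 ^ s) * (6 * (1 - q)⁻¹ ^ 2 * ((q ^ 2)⁻¹ + 1) + 3 * (1 - q)⁻¹ + 1) *
        (1 - ENNReal.ofReal (2 ^ s) * q ^ 2)⁻¹ * A ^ 3 := by
  have hu : l2 u ≠ ⊤ := ne_top_of_le_ne_top
    (ENNReal.mul_ne_top hA (ENNReal.inv_ne_top.mpr (tsub_pos_of_lt hq).ne')) (l2_le_of_LP h)
  set M : ℝ≥0∞ := 6 * (1 - q)⁻¹ ^ 2 * ((q ^ 2)⁻¹ + 1) + 3 * (1 - q)⁻¹ + 1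
  refine sobNorm_le_of_tendsto (F := fun K => ∑ k ∈ Finset.range K, remainderPiece u k)
    (fun n => ?_) fun K => ?_
  · simp_rw [sum_remainderPiece, Pi.sub_apply, Pi.smul_apply, Finset.sum_apply]
    exact (tendsto_cube_lowSum h hA hq n).sub ((tendsto_sum_para (dmul u u) u n).const_smul 3)
  · refine (sobNorm_sum_le s _ _).trans ?_
    calc _ ≤ ∑ k ∈ Finset.range K, ENNReal.ofReal (8 ^ s) * M * A ^ 3 *
            (ENNReal.ofReal (2 ^ s) * q ^ 2) ^ k := by
          refine Finset.sum_le_sum fun k _ => ?_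
          refine (sobNorm_le_of_suppLE hs (suppLE_remainderPiece u k)).trans
            ((mul_le_mul_right (l2_remainderPiece_le h hu hq hq0 k) _).trans_eq ?_)
          ring
      _ ≤ ENNReal.ofReal (8 ^ s) * M * A ^ 3 * (1 - ENNReal.ofReal (2 ^ s) * q ^ 2)⁻¹ := by
          rw [← Finset.mul_sum, ← ENNReal.tsum_geometric]
          exact mul_le_mul_right (ENNReal.sum_le_tsum _) _
      _ = _ := by ring

end SDNLW

open SDNLW in
/-- for `s > 0` and `0 < ε < s/2`,
`‖u³ - 3(u² ≺ u)‖_{H^s(𝕋²)} ≲ ‖u‖³_{C^{s-ε}(𝕋²)}`. -/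
theorem statement2 (s ε : ℝ) (hs : 0 < s) (hε : 0 < ε) (hε' : ε < s / 2) :
    ∃ C : ℝ≥0, 0 < C ∧ ∀ u : Distr,
      sobNorm s (cube u - (3 : ℂ) • para (dmul u u) u) ≤ C * (CNorm (s - ε) u) ^ 3 := by
  set q : ℝ≥0∞ := ENNReal.ofReal (2 ^ (-(s - ε))) with hqdef
  have hq : q < 1 := by
    rw [hqdef, ENNReal.ofReal_lt_one]
    exact Real.rpow_lt_one_of_one_lt_of_neg (by norm_num) (by linarith)
  have hq0 : q ≠ 0 := by
    rw [hqdef, Ne, ENNReal.ofReal_eq_zero, not_le]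
    positivity
  have hr : ENNReal.ofReal (2 ^ s) * q ^ 2 < 1 := by
    rw [hqdef, ← ENNReal.ofReal_pow (by positivity), ← ENNReal.ofReal_mul (by positivity),
      ENNReal.ofReal_lt_one, ← Real.rpow_natCast, ← Real.rpow_mul (by norm_num),
      ← Real.rpow_add (by norm_num)]
    exact Real.rpow_lt_one_of_one_lt_of_neg (by norm_num) (by push_cast; linarith)
  set C : ℝ≥0∞ := ENNReal.ofReal (8 ^ s) *
    (6 * (1 - q)⁻¹ ^ 2 * ((q ^ 2)⁻¹ + 1) + 3 * (1 - q)⁻¹ + 1) *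
    (1 - ENNReal.ofReal (2 ^ s) * q ^ 2)⁻¹ with hCdef
  have hC : C ≠ ⊤ := by
    have h1 : (1 - q)⁻¹ ≠ ⊤ := ENNReal.inv_ne_top.mpr (tsub_pos_of_lt hq).ne'
    have h2 : (q ^ 2)⁻¹ ≠ ⊤ := ENNReal.inv_ne_top.mpr (pow_ne_zero 2 hq0)
    have h3 := ENNReal.inv_ne_top.mpr (tsub_pos_of_lt hr).ne'
    rw [hCdef]
    finiteness
  refine ⟨C.toNNReal + 1, by positivity, fun u => ?_⟩
  by_cases hA : CNorm (s - ε) u = ⊤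
  · rw [hA, ENNReal.top_pow (by norm_num), ENNReal.mul_top (by simp)]
    exact le_top
  refine (sobNorm_cube_sub_para_le hs (linfNorm_LP_le (s - ε) u) hA hq hq0).trans ?_
  refine mul_le_mul_left ?_ _
  rw [ENNReal.coe_add, ENNReal.coe_toNNReal hC]
  exact le_self_add
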